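/- arXiv:2303.07947 — 3 statements merged into one kernel-verified Lean document; each statement's English description precedes it below -/
import Mathlib

section
/- For all integers n, k with 1 ≤ k ≤ n−1, the family of chains ∂c, indexed by the (k+2)-element subsets c of Fin (n+1) that contain the vertex 0, is linearly independent over ℤ/2. -/
open Finset

/-- A `k`-cell of the `n`-simplex `Δₙ`: a `(k+1)`-element subset of the vertex set `Fin (n+1)`. -/
abbrev SimplexCell (n k : ℕ) := {s : Finset (Fin (n + 1)) // s.card = k + 1}

/-- The `ℤ/2`-vector space `Cₖ` of mod-2 `k`-chains of the `n`-simplex. -/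
abbrev SimplexChain (n k : ℕ) := SimplexCell n k → ZMod 2

/-- The mod-2 boundary map `∂ₖ : Cₖ → C_{k-1}`: the indicator of a `(k+1)`-element subset `s`
is sent to the sum of the indicators of the `k`-element subsets of `s`.  Equivalently (by
`ℤ/2`-linearity), the coefficient of a `(k-1)`-cell `t` in `∂ₖ x` is the sum of `x s` over
the `k`-cells `s` with `t ⊆ s`. -/
def simplexBoundary (n k : ℕ) : SimplexChain n k →ₗ[ZMod 2] SimplexChain n (k - 1) where
  toFun x t := ∑ s ∈ univ.filter (fun s : SimplexCell n k => t.1 ⊆ s.1), x s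
  map_add' x y := by funext t; exact Finset.sum_add_distrib
  map_smul' c x := by funext t; simp [Finset.mul_sum]

/-- `∂c` for a `(k+2)`-element vertex subset `c`: the boundary `∂_{k+1}` of the indicator of
the `(k+1)`-simplex with vertex set `c`; it is a `k`-chain (a `k`-dimensional sphere). -/
def simplexSphere (n k : ℕ) (c : Finset (Fin (n + 1))) : SimplexChain n k :=
  simplexBoundary n (k + 1) (fun s : SimplexCell n (k + 1) => if s.1 = c then 1 else 0)

/-- The coefficient of a `k`-cell `t` in the sphere `∂c` is `1` exactly when `t` is a facet of `c`. -/
lemma simplexSphere_apply {n k : ℕ} {c : Finset (Fin (n + 1))} (hc : c.card = k + 2)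
    (t : SimplexCell n k) : simplexSphere n k c t = if t.1 ⊆ c then 1 else 0 := by
  change ∑ s ∈ univ.filter (fun s : SimplexCell n (k + 1) => t.1 ⊆ s.1),
    (if s.1 = c then (1 : ZMod 2) else 0) = _
  have h (s : SimplexCell n (k + 1)) : s.1 = c ↔ s = ⟨c, hc⟩ := by rw [Subtype.ext_iff]
  simp [h, Finset.sum_ite_eq']

/-- A set `d` containing `a`, of the same size as `c`, contains `c` minus `a` only if it equals `c`. -/
lemma Finset.erase_subset_iff_eq_of_card_eq {α : Type*} [DecidableEq α] {a : α} {c d : Finset α}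
    (had : a ∈ d) (hcard : c.card = d.card) : c.erase a ⊆ d ↔ d = c := by
  refine ⟨fun h => (eq_of_subset_of_card_le ?_ hcard.ge).symm, fun h => h ▸ erase_subset a d⟩
  simpa [insert_eq_of_mem had] using subset_insert_iff.2 h

/-- For `1 ≤ k ≤ n-1`, the chains `∂c`, indexed by the `(k+2)`-element
subsets `c` of `Fin (n+1)` containing the vertex `0`, are linearly independent over `ℤ/2`. -/
theorem simplex_sphere_family_linearIndependent (n k : ℕ) (hk : 1 ≤ k) (hkn : k ≤ n - 1) :
    LinearIndependent (ZMod 2)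
      (fun c : {c : Finset (Fin (n + 1)) // c.card = k + 2 ∧ (0 : Fin (n + 1)) ∈ c} =>
        simplexSphere n k c.1) := by
  rw [Fintype.linearIndependent_iff]
  rintro g hg ⟨c, hc, h0⟩
  have hface : (c.erase 0).card = k + 1 := by rw [card_erase_of_mem h0, hc]; rfl
  have hcoeff := congrFun hg ⟨c.erase 0, hface⟩
  have hiff (d : {c : Finset (Fin (n + 1)) // c.card = k + 2 ∧ (0 : Fin (n + 1)) ∈ c}) :
      c.erase 0 ⊆ d.1 ↔ d = ⟨c, hc, h0⟩ := by
    rw [Finset.erase_subset_iff_eq_of_card_eq d.2.2 (hc.trans d.2.1.symm), Subtype.ext_iff]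
  have happly (d : {c : Finset (Fin (n + 1)) // c.card = k + 2 ∧ (0 : Fin (n + 1)) ∈ c}) :
      simplexSphere n k d.1 ⟨c.erase 0, hface⟩ = if d = ⟨c, hc, h0⟩ then 1 else 0 := by
    simp only [simplexSphere_apply d.2.1, hiff]
  simpa [Finset.sum_apply, happly] using hcoeff
end

section
/- For all integers n, k with 1 ≤ k ≤ n−1, every ℤ/2 k-cycle of the n-cube (every element of the kernel of ∂_k) is the mod-2 sum of a set of at most s(n,k) := Σ_{j=k}^{n−1} binomial(j,k)·2^{j−k} distinct members of the cube sphere family B(n,k). -/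
open Finset

/-- A `k`-face of the `n`-cube `Qₙ = [0,1]^n`, encoded as a function `Fin n → Option Bool`:
`g j = none` means coordinate `j` is free and `g j = some b` means coordinate `j` is fixed at
the value `b` (`false` for `0`, `true` for `1`).  A `k`-face has exactly `k` free coordinates.
This encodes the pair `(S, f)` with `S = {j | g j = none}` the `k`-element set of free
coordinates and `f : j ∉ S → {0,1}` the fixed values. -/
abbrev CubeCell (n k : ℕ) :=
  {g : Fin n → Option Bool // (univ.filter fun j => g j = none).card = k}

/-- The `ℤ/2`-vector space `Cₖ` of mod-2 `k`-chains of the `n`-cube. -/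
abbrev CubeChain (n k : ℕ) := CubeCell n k → ZMod 2

/-- `(T, g)` is a face of `(S, f)` iff `T ⊆ S` and `g j = f j` for every coordinate `j ∉ S`;
in this encoding: wherever the bigger face is fixed, the smaller face is fixed at the same
value. -/
def IsCubeSubface {n l k : ℕ} (h : CubeCell n l) (g : CubeCell n k) : Prop :=
  ∀ j, g.1 j ≠ none → h.1 j = g.1 j

instance {n l k : ℕ} (h : CubeCell n l) (g : CubeCell n k) : Decidable (IsCubeSubface h g) :=
  inferInstanceAs (Decidable (∀ j, g.1 j ≠ none → h.1 j = g.1 j))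

/-- The mod-2 boundary map `∂ₖ : Cₖ → C_{k-1}`: the indicator of a `k`-face `(S, f)` is sent
to the sum of the indicators of its `2k` facets `(S \ {i}, f_{i↦ε})` for `i ∈ S`, `ε ∈ {0,1}`.
Equivalently (by `ℤ/2`-linearity), the coefficient of a `(k-1)`-face `h` in `∂ₖ x` is the sum
of `x g` over the `k`-faces `g` having `h` as a face (each such `h` arises from a unique
pair `(i, ε)`). -/
def cubeBoundary (n k : ℕ) : CubeChain n k →ₗ[ZMod 2] CubeChain n (k - 1) where
  toFun x h := ∑ g ∈ univ.filter (fun g : CubeCell n k => IsCubeSubface h g), x g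
  map_add' x y := by funext t; exact Finset.sum_add_distrib
  map_smul' c x := by funext t; simp [Finset.mul_sum]

/-- Membership in the cube family `C(n,k)` (stated for a face of any dimension; it is used for
`(k+1)`-faces): `(S, f)` is in the family iff `f j = 0` for every fixed coordinate `j ∉ S`
exceeding `max S`, i.e. exceeding every free coordinate. -/
def InCubeFamily {n k : ℕ} (g : CubeCell n k) : Prop :=
  ∀ j, g.1 j ≠ none → (∀ i, g.1 i = none → i < j) → g.1 j = some false

instance {n k : ℕ} (g : CubeCell n k) : Decidable (InCubeFamily g) :=
  inferInstanceAs
    (Decidable (∀ j, g.1 j ≠ none → (∀ i, g.1 i = none → i < j) → g.1 j = some false))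

/-- `∂_{k+1}(S,f)` for a `(k+1)`-face `(S,f)`: the boundary of the indicator of that
`(k+1)`-cube; it is a `k`-chain (a `k`-dimensional sphere). -/
def cubeSphere (n k : ℕ) (c : CubeCell n (k + 1)) : CubeChain n k :=
  cubeBoundary n (k + 1) (fun g => if g = c then 1 else 0)

/-- The set of free coordinates of a face. -/
def freeCoords {n : ℕ} (g : Fin n → Option Bool) : Finset (Fin n) :=
  univ.filter fun j => g j = none

theorem mem_freeCoords {n : ℕ} {g : Fin n → Option Bool} {j : Fin n} :
    j ∈ freeCoords g ↔ g j = none := by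
  simp [freeCoords]

theorem card_freeCoords {n k : ℕ} (g : CubeCell n k) : (freeCoords g.1).card = k := g.2

theorem freeCoords_update_some {n : ℕ} (g : Fin n → Option Bool) (m : Fin n) (b : Bool) :
    freeCoords (Function.update g m (some b)) = (freeCoords g).erase m := by
  ext j
  by_cases hj : j = m
  · subst hj; simp [mem_freeCoords]
  · simp [mem_freeCoords, hj]

theorem freeCoords_update_none {n : ℕ} (g : Fin n → Option Bool) (m : Fin n) :
    freeCoords (Function.update g m none) = insert m (freeCoords g) := by
  ext j
  by_cases hj : j = m
  · subst hj; simp [mem_freeCoords]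
  · simp [mem_freeCoords, hj]

theorem IsCubeSubface.freeCoords_subset {n l k : ℕ} {h : CubeCell n l} {g : CubeCell n k}
    (H : IsCubeSubface h g) : freeCoords h.1 ⊆ freeCoords g.1 := by
  intro j hj
  rw [mem_freeCoords] at *
  by_contra hg
  exact hg ((H j hg).symm.trans hj)

/-- A facet `h` of `g` together with the free coordinate of `g` that is fixed in `h`
determines `g`. -/
theorem IsCubeSubface.eq_update_none {n l k : ℕ} {h : CubeCell n l} {g : CubeCell n k}
    (H : IsCubeSubface h g) (hlk : k = l + 1) {m : Fin n} (hm : h.1 m ≠ none)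
    (gm : g.1 m = none) : g.1 = Function.update h.1 m none := by
  have hins : insert m (freeCoords h.1) = freeCoords g.1 := by
    apply Finset.eq_of_subset_of_card_le
    · exact insert_subset (mem_freeCoords.2 gm) H.freeCoords_subset
    · rw [card_insert_of_notMem (by rwa [mem_freeCoords]), card_freeCoords, card_freeCoords, hlk]
  funext j
  by_cases hj : j = m
  · subst hj; simpa using gm
  · rw [Function.update_of_ne hj]
    by_cases hg : g.1 j = none
    · have := mem_freeCoords.2 hg
      rw [← hins, mem_insert, mem_freeCoords] at this
      rw [hg, this.resolve_left hj]
    · exact (H j hg).symm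

theorem cubeBoundary_apply {n k : ℕ} (x : CubeChain n k) (h : CubeCell n (k - 1)) :
    cubeBoundary n k x h = ∑ g ∈ univ.filter (fun g : CubeCell n k => IsCubeSubface h g), x g :=
  rfl

theorem cubeSphere_apply {n k : ℕ} (c : CubeCell n (k + 1)) (g : CubeCell n k) :
    cubeSphere n k c g = if IsCubeSubface g c then 1 else 0 := by
  refine (cubeBoundary_apply (k := k + 1) _ g).trans ?_
  simp [Finset.sum_ite_eq']

/-- Given `h ≤ g ≤ c` with `h` of codimension two in `c`, the other face strictly between `h`
and `c`. -/
def oppositeFace {n : ℕ} (h g c : Fin n → Option Bool) : Fin n → Option Bool := fun j =>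
  if c j = none ∧ h j ≠ none then (if g j = none then h j else none) else g j

theorem card_freeCoords_oppositeFace {n k : ℕ} (hk : 1 ≤ k) {h : CubeCell n (k - 1)}
    {g : CubeCell n k} {c : CubeCell n (k + 1)} (hg : IsCubeSubface h g)
    (gc : IsCubeSubface g c) : (freeCoords (oppositeFace h.1 g.1 c.1)).card = k := by
  have h1 := hg.freeCoords_subset
  have h2 := gc.freeCoords_subset
  have : freeCoords (oppositeFace h.1 g.1 c.1)
      = freeCoords h.1 ∪ (freeCoords c.1 \ freeCoords g.1) := by
    ext j
    have h1 := @h1 j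
    have h2 := @h2 j
    simp only [mem_freeCoords, mem_union, mem_sdiff, oppositeFace] at *
    grind
  rw [this, card_union_of_disjoint, card_sdiff_of_subset h2]
  · simp only [card_freeCoords]; omega
  · rw [disjoint_left]
    intro j hj hj'
    exact (mem_sdiff.1 hj').2 (h1 hj)

theorem cubeBoundary_cubeSphere {n k : ℕ} (hk : 1 ≤ k) (c : CubeCell n (k + 1)) :
    cubeBoundary n k (cubeSphere n k c) = 0 := by
  funext h
  rw [cubeBoundary_apply]
  simp only [cubeSphere_apply, Pi.zero_apply]
  rw [← Finset.sum_filter]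
  have key : ∀ g ∈ filter (fun g => IsCubeSubface g c)
      (filter (fun g : CubeCell n k => IsCubeSubface h g) univ),
      IsCubeSubface h g ∧ IsCubeSubface g c := by
    intro g hg; simpa using hg
  refine Finset.sum_involution (fun g hg => ⟨oppositeFace h.1 g.1 c.1,
    card_freeCoords_oppositeFace hk (key g hg).1 (key g hg).2⟩) ?_ ?_ ?_ ?_
  · intros; decide
  · intro g hg _ heq
    obtain ⟨h1, h2⟩ := key g hg
    have hne : (freeCoords c.1 \ freeCoords h.1).Nonempty := by
      apply sdiff_nonempty_of_card_lt_card
      simp only [card_freeCoords]; omega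
    obtain ⟨j, hj⟩ := hne
    rw [mem_sdiff, mem_freeCoords, mem_freeCoords] at hj
    have := congrFun (congrArg Subtype.val heq) j
    simp only [oppositeFace] at this
    grind
  · intro g hg
    obtain ⟨h1, h2⟩ := key g hg
    simp only [mem_filter, mem_univ, true_and]
    constructor
    · intro j hj
      have := h1 j
      simp only [oppositeFace] at *
      grind
    · intro j hj
      have := h2 j
      simp only [oppositeFace] at *
      grind
  · intro g hg
    obtain ⟨h1, h2⟩ := key g hg
    apply Subtype.ext
    funext j
    have := h1 j
    simp only [oppositeFace]
    grind

/-- The faces for which `m` is the largest free coordinate and all later coordinates vanish. -/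
def familyWithMax (n k : ℕ) (m : Fin n) : Finset (CubeCell n k) :=
  univ.filter fun c => c.1 m = none ∧ ∀ j, m < j → c.1 j = some false

theorem mem_familyWithMax {n k : ℕ} {m : Fin n} {c : CubeCell n k} :
    c ∈ familyWithMax n k m ↔ c.1 m = none ∧ ∀ j, m < j → c.1 j = some false := by
  simp [familyWithMax]

theorem inCubeFamily_of_mem_familyWithMax {n k : ℕ} {m : Fin n} {c : CubeCell n k}
    (hc : c ∈ familyWithMax n k m) : InCubeFamily c := fun j _ hj =>
  (mem_familyWithMax.1 hc).2 j (hj m (mem_familyWithMax.1 hc).1)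

theorem InCubeFamily.exists_mem_familyWithMax {n k : ℕ} {c : CubeCell n (k + 1)}
    (hc : InCubeFamily c) : ∃ m, c ∈ familyWithMax n (k + 1) m := by
  have hne : (freeCoords c.1).Nonempty := by
    rw [← card_pos, card_freeCoords]; omega
  have hmax := fun i (hi : c.1 i = none) => le_max' (freeCoords c.1) i (mem_freeCoords.2 hi)
  refine ⟨(freeCoords c.1).max' hne, mem_familyWithMax.2
    ⟨mem_freeCoords.1 (max'_mem _ hne), fun j hj => hc j ?_ ?_⟩⟩
  · intro h
    exact absurd (hmax j h) (not_le.2 hj)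
  · intro i hi
    exact (hmax i hi).trans_lt hj

theorem card_familyWithMax_le (n k : ℕ) (m : Fin n) :
    (familyWithMax n (k + 1) m).card ≤ (m : ℕ).choose k * 2 ^ ((m : ℕ) - k) := by
  have hcard : (((Iio m).powersetCard k).sigma fun T => (Iio m \ T).powerset).card
      = (m : ℕ).choose k * 2 ^ ((m : ℕ) - k) := by
    rw [card_sigma, sum_congr rfl (g := fun _ => 2 ^ ((m : ℕ) - k)), sum_const, card_powersetCard,
      Fin.card_Iio, smul_eq_mul]
    intro T hT
    rw [mem_powersetCard] at hT
    rw [card_powerset, card_sdiff_of_subset hT.1, Fin.card_Iio, hT.2]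
  rw [← hcard]
  refine card_le_card_of_injOn
    (fun c => ⟨(freeCoords c.1).erase m, univ.filter fun j => c.1 j = some true⟩) ?_ ?_
  · intro c hc
    obtain ⟨hm, hgt⟩ := mem_familyWithMax.1 hc
    simp only [coe_sigma, Set.mem_sigma_iff, mem_coe, mem_powersetCard, mem_powerset]
    refine ⟨⟨?_, ?_⟩, ?_⟩
    · intro j hj
      rw [mem_erase, mem_freeCoords] at hj
      have := hgt j
      rw [mem_Iio]
      grind
    · rw [card_erase_of_mem (mem_freeCoords.2 hm), card_freeCoords]; rfl
    · intro j hj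
      have := hgt j
      simp only [mem_filter, mem_univ, true_and, mem_sdiff, mem_Iio, mem_erase,
        mem_freeCoords] at *
      grind
  · intro c hc d hd hcd
    obtain ⟨hm, -⟩ := mem_familyWithMax.1 hc
    obtain ⟨hm', -⟩ := mem_familyWithMax.1 hd
    simp only [Sigma.mk.injEq, heq_eq_eq] at hcd
    obtain ⟨h1, h2⟩ := hcd
    apply Subtype.ext
    funext j
    have h1 := Finset.ext_iff.1 h1 j
    have h2 := Finset.ext_iff.1 h2 j
    simp only [mem_erase, mem_freeCoords, mem_filter, mem_univ, true_and] at h1 h2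
    by_cases hj : j = m
    · rw [hj, hm, hm']
    · rcases hcj : c.1 j with _ | _ | _ <;> rcases hdj : d.1 j with _ | _ | _ <;> simp_all

theorem card_cubeFamily_le (n k : ℕ) :
    (univ.filter fun c : CubeCell n (k + 1) => InCubeFamily c).card
      ≤ ∑ j ∈ Ico k n, j.choose k * 2 ^ (j - k) := by
  calc _ ≤ (univ.biUnion (familyWithMax n (k + 1))).card := by
        apply card_le_card
        intro c hc
        obtain ⟨m, hm⟩ := (mem_filter.1 hc).2.exists_mem_familyWithMax
        exact mem_biUnion.2 ⟨m, mem_univ m, hm⟩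
    _ ≤ ∑ m : Fin n, (m : ℕ).choose k * 2 ^ ((m : ℕ) - k) :=
        card_biUnion_le.trans (sum_le_sum fun m _ => card_familyWithMax_le n k m)
    _ = ∑ j ∈ range n, j.choose k * 2 ^ (j - k) :=
        Fin.sum_univ_eq_sum_range (fun j => j.choose k * 2 ^ (j - k)) n
    _ = _ := by
        symm
        apply sum_subset
        · intro j hj
          exact mem_range.2 (mem_Ico.1 hj).2
        · intro j hj hj'
          rw [mem_range] at hj
          rw [mem_Ico] at hj'
          rw [Nat.choose_eq_zero_of_lt (by omega), zero_mul]

/-- The value of a chain on a face of unspecified dimension, zero in the wrong dimension. -/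
def extendChain {n k : ℕ} (z : CubeChain n k) (g : Fin n → Option Bool) : ZMod 2 :=
  if h : (freeCoords g).card = k then z ⟨g, h⟩ else 0

theorem extendChain_val {n k : ℕ} (z : CubeChain n k) (g : CubeCell n k) :
    extendChain z g.1 = z g := by
  simp [extendChain, card_freeCoords]

/-- A combination of spheres agreeing with `z` on the faces that lie in `x_m = 1` and vanish
beyond `m`. -/
def sphereSweep {n k : ℕ} (z : CubeChain n k) (m : Fin n) : CubeChain n k :=
  ∑ c ∈ familyWithMax n (k + 1) m,
    extendChain z (Function.update c.1 m (some true)) • cubeSphere n k c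

theorem sphereSweep_apply {n k : ℕ} (z : CubeChain n k) (m : Fin n) (g : CubeCell n k) :
    sphereSweep z m g = ∑ c ∈ familyWithMax n (k + 1) m,
      extendChain z (Function.update c.1 m (some true)) *
        if IsCubeSubface g c then 1 else 0 := by
  simp only [sphereSweep, Finset.sum_apply, Pi.smul_apply, smul_eq_mul, cubeSphere_apply]

theorem sphereSweep_apply_eq_zero {n k : ℕ} (z : CubeChain n k) {m j : Fin n} (hj : m < j)
    {g : CubeCell n k} (hg : g.1 j ≠ some false) : sphereSweep z m g = 0 := by
  rw [sphereSweep_apply]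
  refine sum_eq_zero fun c hc => ?_
  have hcj := (mem_familyWithMax.1 hc).2 j hj
  rw [if_neg, mul_zero]
  intro H
  exact hg ((H j (by simp [hcj])).trans hcj)

theorem sphereSweep_apply_of_eq_true {n k : ℕ} (z : CubeChain n k) {m : Fin n}
    {g : CubeCell n k} (hgm : g.1 m = some true) (hg : ∀ j, m < j → g.1 j = some false) :
    sphereSweep z m g = z g := by
  rw [sphereSweep_apply]
  have hcard : (freeCoords (Function.update g.1 m none)).card = k + 1 := by
    rw [freeCoords_update_none, card_insert_of_notMem (by simp [mem_freeCoords, hgm]),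
      card_freeCoords]
  rw [Finset.sum_eq_single (⟨Function.update g.1 m none, hcard⟩ : CubeCell n (k + 1))]
  · rw [if_pos, mul_one]
    · have : Function.update (Function.update g.1 m none) m (some true) = g.1 := by
        rw [Function.update_idem, Function.update_eq_self_iff.2 hgm.symm]
      rw [this, extendChain_val]
    · intro j hj
      by_cases hjm : j = m
      · subst hjm; simp at hj
      · simp [hjm]
  · intro c hc hne
    rw [if_neg, mul_zero]
    intro H
    exact hne (Subtype.ext (H.eq_update_none rfl (by simp [hgm]) (mem_familyWithMax.1 hc).1))
  · intro hc
    refine absurd (mem_familyWithMax.2 ⟨by simp, fun j hj => ?_⟩) hc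
    simpa [hj.ne'] using hg j hj

/-- The spheres bounding the faces of the cube family. -/
def familySpheres (n k : ℕ) : Finset (CubeChain n k) :=
  (univ.filter fun c : CubeCell n (k + 1) => InCubeFamily c).image (cubeSphere n k)

theorem sphereSweep_mem_span {n k : ℕ} (z : CubeChain n k) (m : Fin n) :
    sphereSweep z m ∈ Submodule.span (ZMod 2) (familySpheres n k : Set (CubeChain n k)) := by
  refine Submodule.sum_mem _ fun c hc => Submodule.smul_mem _ _ (Submodule.subset_span ?_)
  exact mem_coe.2 (mem_image_of_mem _
    (mem_filter.2 ⟨mem_univ _, inCubeFamily_of_mem_familyWithMax hc⟩))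

theorem cubeBoundary_sphereSweep {n k : ℕ} (hk : 1 ≤ k) (z : CubeChain n k) (m : Fin n) :
    cubeBoundary n k (sphereSweep z m) = 0 := by
  simp [sphereSweep, map_sum, cubeBoundary_cubeSphere hk]

/-- A cycle without faces in `x_m = 1` has no faces in the direction `m`. -/
theorem cycle_apply_eq_zero_of_free {n k : ℕ} (hk : 1 ≤ k) {z : CubeChain n k}
    (hz : cubeBoundary n k z = 0) {m : Fin n} (hm : ∀ g, g.1 m = some true → z g = 0)
    {g : CubeCell n k} (hg : g.1 m = none) : z g = 0 := by
  have hcard : (freeCoords (Function.update g.1 m (some true))).card = k - 1 := by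
    rw [freeCoords_update_some, card_erase_of_mem (mem_freeCoords.2 hg), card_freeCoords]
  have h0 := congrFun hz ⟨Function.update g.1 m (some true), hcard⟩
  rw [cubeBoundary_apply, Finset.sum_eq_single g] at h0
  · exact h0
  · intro g' hg' hne
    have H := (mem_filter.1 hg').2
    by_cases hfree : g'.1 m = none
    · refine absurd (Subtype.ext ?_) hne
      rw [H.eq_update_none (by omega) (by simp) hfree, Function.update_idem,
        Function.update_eq_self_iff.2 hg.symm]
    · refine hm g' ?_
      rw [← H m hfree]
      simp
  · intro hg'
    refine absurd (mem_filter.2 ⟨mem_univ _, fun j hj => ?_⟩) hg'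
    have : j ≠ m := by rintro rfl; exact hj hg
    simp [this]

theorem cycle_mem_span_of_support {n k : ℕ} (hk : 1 ≤ k) (m : ℕ) (hmn : m ≤ n)
    (z : CubeChain n k) (hz : cubeBoundary n k z = 0)
    (hsupp : ∀ g, z g ≠ 0 → ∀ j : Fin n, m ≤ j → g.1 j = some false) :
    z ∈ Submodule.span (ZMod 2) (familySpheres n k : Set (CubeChain n k)) := by
  induction m generalizing z with
  | zero =>
    have : z = 0 := by
      funext g
      by_contra hg
      have hempty : freeCoords g.1 = ∅ := by
        ext j
        simp [mem_freeCoords, hsupp g hg j (Nat.zero_le _)]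
      have := card_freeCoords g
      rw [hempty, card_empty] at this
      omega
    rw [this]
    exact Submodule.zero_mem _
  | succ m ih =>
    let p : Fin n := ⟨m, hmn⟩
    rw [← sub_add_cancel z (sphereSweep z p)]
    have hcycle : cubeBoundary n k (z - sphereSweep z p) = 0 := by
      rw [map_sub, hz, cubeBoundary_sphereSweep hk, sub_zero]
    have habove : ∀ g, (z - sphereSweep z p) g ≠ 0 → ∀ j, p < j → g.1 j = some false := by
      intro g hg j hj
      by_contra hne
      have hzg : z g = 0 := by
        by_contra h
        exact hne (hsupp g h j hj)
      exact hg (by rw [Pi.sub_apply, hzg, sphereSweep_apply_eq_zero z hj hne, sub_zero])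
    have htrue : ∀ g, g.1 p = some true → (z - sphereSweep z p) g = 0 := by
      intro g hg
      by_contra hne
      exact hne (by rw [Pi.sub_apply, sphereSweep_apply_of_eq_true z hg (habove g hne), sub_self])
    refine Submodule.add_mem _ (ih (by omega) _ hcycle fun g hg j hj => ?_)
      (sphereSweep_mem_span z p)
    rcases (show p ≤ j from hj).eq_or_lt with rfl | hlt
    · rcases hgp : g.1 p with _ | _ | _
      · exact absurd (cycle_apply_eq_zero_of_free hk hcycle htrue hgp) hg
      · rfl
      · exact absurd (htrue g hgp) hg
    · exact habove g hg j hlt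

/-- For `1 ≤ k ≤ n-1`, every `ℤ/2` `k`-cycle of the `n`-cube is the mod-2
sum of a set of at most `s(n,k) = Σ_{j=k}^{n-1} binomial (j,k) · 2^{j-k}` distinct members of
the cube sphere family `B(n,k) = {∂_{k+1}(S,f) : (S,f) ∈ C(n,k)}`. -/
theorem cube_cycle_eq_sum_of_spheres (n k : ℕ) (hk : 1 ≤ k) (hkn : k ≤ n - 1) :
    ∀ z ∈ LinearMap.ker (cubeBoundary n k),
      ∃ F : Finset (CubeChain n k),
        (↑F : Set (CubeChain n k)) ⊆
            {w : CubeChain n k | ∃ c : CubeCell n (k + 1),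
              InCubeFamily c ∧ w = cubeSphere n k c} ∧
        F.card ≤ ∑ j ∈ Finset.Ico k n, j.choose k * 2 ^ (j - k) ∧
        z = ∑ w ∈ F, w := by
  intro z hz
  obtain ⟨a, -, ha⟩ := Submodule.mem_span_finset.1 (cycle_mem_span_of_support hk n le_rfl z
    (LinearMap.mem_ker.1 hz) fun _ _ j hj => absurd j.2 (not_lt.2 hj))
  refine ⟨(familySpheres n k).filter fun w => a w = 1, ?_, ?_, ?_⟩
  · intro w hw
    obtain ⟨c, hc, rfl⟩ := mem_image.1 (mem_filter.1 (mem_coe.1 hw)).1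
    exact ⟨c, (mem_filter.1 hc).2, rfl⟩
  · exact (card_filter_le _ _).trans (card_image_le.trans (card_cubeFamily_le n k))
  · rw [← ha, sum_filter]
    refine sum_congr rfl fun w _ => ?_
    have h01 : ∀ t : ZMod 2, t = 0 ∨ t = 1 := by decide
    rcases h01 (a w) with h | h <;> simp [h]
end

section
/- For every integer n ≥ 4, Σ_{i=4}^{n} binomial(n, i) · binomial(i−1, 3) = Σ_{j=3}^{n−1} binomial(j, 3) · 2^{j−3}; that is, bw(n,4) = s(n,3). -/
theorem sum_choose_mul_choose {k n : ℕ} (h : k ≤ n) :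
    ∑ i ∈ Finset.Ico k (n + 1), n.choose i * i.choose k = n.choose k * 2 ^ (n - k) := by
  rw [Finset.sum_Ico_eq_sum_range, Nat.sub_add_comm h, ← Nat.sum_range_choose, Finset.mul_sum]
  refine Finset.sum_congr rfl fun i hi => ?_
  have hi' := Finset.mem_range.mp hi
  rw [Nat.choose_mul (by omega), Nat.add_sub_cancel_left]

theorem sum_choose_succ_mul_choose {k n : ℕ} (h : k ≤ n) :
    ∑ i ∈ Finset.Ico k n, n.choose (i + 1) * i.choose k =
      ∑ j ∈ Finset.Ico k n, j.choose k * 2 ^ (j - k) := by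
  induction n, h using Nat.le_induction with
  | base => simp
  | succ n h ih =>
    simp only [Nat.choose_succ_succ', add_mul, Finset.sum_add_distrib]
    rw [sum_choose_mul_choose h, Finset.sum_Ico_succ_top h, ih, Finset.sum_Ico_succ_top h]
    simp [add_comm]

/-- For every `n ≥ 4`,
`Σ_{i=4}^{n} binomial (n,i) · binomial (i−1, 3) = Σ_{j=3}^{n-1} binomial (j,3) · 2^{j-3}`;
that is, `bw(n,4) = s(n,3)`. -/
theorem bw_four_eq_s_three (n : ℕ) (hn : 4 ≤ n) :
    ∑ i ∈ Finset.Icc 4 n, n.choose i * (i - 1).choose 3 =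
      ∑ j ∈ Finset.Ico 3 n, j.choose 3 * 2 ^ (j - 3) := by
  rw [← sum_choose_succ_mul_choose (by omega : 3 ≤ n)]
  exact (Finset.sum_Ico_add' (fun i => n.choose i * (i - 1).choose 3) 3 n 1).symm
end
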